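/- Let k, n ≥ 1 and let S_{i,j} ⊆ {1,…,n}×{1,…,n} be nonempty for all i, j ∈ {1,…,k}. Then the following are equivalent: (1) there exists a grid-tiling solution (s_{i,j})_{i,j∈{1,…,k}}; (2) there exists a subset B' ⊆ B with |B'| = k² such that every voter position has a unique nearest box in B' and red wins at every box of B'. -/

import Mathlib

open scoped Classical

noncomputable section

/-- Euclidean distance between two points of the plane `ℝ × ℝ`. -/
def edist2 (a b : ℝ × ℝ) : ℝ := Real.sqrt ((a.1 - b.1) ^ 2 + (a.2 - b.2) ^ 2)

/-- The grid scale `L = 10n² + 4n`. -/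
def Lc (n : ℕ) : ℝ := 10 * (n : ℝ) ^ 2 + 4 * (n : ℝ)

/-- The ballot box `b^{i,j}_{(p,q)}`. -/
def bbox (n i j p q : ℕ) : ℝ × ℝ :=
  ((if Even i then Lc n * ((i : ℝ) - 1) + 5 * (n : ℝ) ^ 2 + 4 * (p : ℝ)
    else Lc n * ((i : ℝ) - 1) + 5 * (n : ℝ) ^ 2 + 4 * ((n : ℝ) - (p : ℝ))),
   (if Even j then Lc n * ((j : ℝ) - 1) + 5 * (n : ℝ) ^ 2 + 4 * (q : ℝ)
    else Lc n * ((j : ℝ) - 1) + 5 * (n : ℝ) ^ 2 + 4 * ((n : ℝ) - (q : ℝ))))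

/-- The voter position `V_←^{i,j}`. -/
def Vl (n i j : ℕ) : ℝ × ℝ :=
  (Lc n * ((i : ℝ) - 1) + 1, Lc n * ((j : ℝ) - 1) + 5 * (n : ℝ) ^ 2 + 2 * (n : ℝ))

/-- The voter position `V_→^{i,j}`. -/
def Vr (n i j : ℕ) : ℝ × ℝ :=
  (Lc n * (i : ℝ) - 1, Lc n * ((j : ℝ) - 1) + 5 * (n : ℝ) ^ 2 + 2 * (n : ℝ))

/-- The voter position `V_↑^{i,j}`. -/
def Vu (n i j : ℕ) : ℝ × ℝ :=
  (Lc n * ((i : ℝ) - 1) + 5 * (n : ℝ) ^ 2 + 2 * (n : ℝ), Lc n * ((j : ℝ) - 1) + 1)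

/-- The voter position `V_↓^{i,j}`. -/
def Vd (n i j : ℕ) : ℝ × ℝ :=
  (Lc n * ((i : ℝ) - 1) + 5 * (n : ℝ) ^ 2 + 2 * (n : ℝ), Lc n * (j : ℝ) - 1)

/-- The center position `c^{i,j}` where the red voters sit. -/
def cpos (n i j : ℕ) : ℝ × ℝ :=
  (Lc n * ((i : ℝ) - 1) + 5 * (n : ℝ) ^ 2 + 2 * (n : ℝ),
   Lc n * ((j : ℝ) - 1) + 5 * (n : ℝ) ^ 2 + 2 * (n : ℝ))

/-- `b` is the (unique, strictly) nearest box of `B'` to the position `v`. -/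
def nearestIn (B' : Set (ℝ × ℝ)) (v b : ℝ × ℝ) : Prop :=
  b ∈ B' ∧ ∀ b' ∈ B', b' ≠ b → edist2 v b < edist2 v b'

/-- The five voter positions of the cell `(i,j)`. -/
def fivePos (n i j : ℕ) : Set (ℝ × ℝ) :=
  {cpos n i j, Vl n i j, Vr n i j, Vu n i j, Vd n i j}

/-- All voter positions of the instance. -/
def allPositions (k n : ℕ) : Set (ℝ × ℝ) :=
  {v | ∃ i j, 1 ≤ i ∧ i ≤ k ∧ 1 ≤ j ∧ j ≤ k ∧ v ∈ fivePos n i j}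

/-- The set of available ballot boxes determined by the grid-tiling sets `S`. -/
def Bset (k n : ℕ) (S : ℕ → ℕ → Set (ℕ × ℕ)) : Set (ℝ × ℝ) :=
  {x | ∃ i j p q, 1 ≤ i ∧ i ≤ k ∧ 1 ≤ j ∧ j ≤ k ∧ (p, q) ∈ S i j ∧ x = bbox n i j p q}

/-- The available ballot boxes of the cell `(i,j)`. -/
def Bij (n i j : ℕ) (S : ℕ → ℕ → Set (ℕ × ℕ)) : Set (ℝ × ℝ) :=
  {x | ∃ p q, (p, q) ∈ S i j ∧ x = bbox n i j p q}

/-- The number of red voters voting at box `b` when the open boxes are `B'`: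
`4·5^{(i-1)k+(j-1)} + 1` red voters sit at each center `c^{i,j}`. -/
def redCount (k n : ℕ) (B' : Set (ℝ × ℝ)) (b : ℝ × ℝ) : ℕ :=
  ∑ i ∈ Finset.Icc 1 k, ∑ j ∈ Finset.Icc 1 k,
    if nearestIn B' (cpos n i j) b then 4 * 5 ^ ((i - 1) * k + (j - 1)) + 1 else 0

/-- The number of blue voters voting at box `b` when the open boxes are `B'`:
`5^{(i-1)k+(j-1)}` blue voters sit at each of `V_←^{i,j}`, `V_→^{i,j}`,
`V_↑^{i,j}`, `V_↓^{i,j}`. -/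
def blueCount (k n : ℕ) (B' : Set (ℝ × ℝ)) (b : ℝ × ℝ) : ℕ :=
  ∑ i ∈ Finset.Icc 1 k, ∑ j ∈ Finset.Icc 1 k,
    ((if nearestIn B' (Vl n i j) b then 5 ^ ((i - 1) * k + (j - 1)) else 0) +
     (if nearestIn B' (Vr n i j) b then 5 ^ ((i - 1) * k + (j - 1)) else 0) +
     (if nearestIn B' (Vu n i j) b then 5 ^ ((i - 1) * k + (j - 1)) else 0) +
     (if nearestIn B' (Vd n i j) b then 5 ^ ((i - 1) * k + (j - 1)) else 0))

/-- Red wins at box `b`: strictly more red than blue voters vote at `b`. -/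
def redWins (k n : ℕ) (B' : Set (ℝ × ℝ)) (b : ℝ × ℝ) : Prop :=
  blueCount k n B' b < redCount k n B' b

/-- `s` is a solution of the grid-tiling instance `S`. -/
def IsGridSolution (k : ℕ) (S : ℕ → ℕ → Set (ℕ × ℕ)) (s : ℕ → ℕ → ℕ × ℕ) : Prop :=
  (∀ i j, 1 ≤ i → i ≤ k → 1 ≤ j → j ≤ k → s i j ∈ S i j) ∧
  (∀ i j, 1 ≤ i → i < k → 1 ≤ j → j ≤ k → (s i j).1 = (s (i + 1) j).1) ∧
  (∀ i j, 1 ≤ i → i ≤ k → 1 ≤ j → j < k → (s i j).2 = (s i (j + 1)).2)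

/-! ### Counting: the votes of each cell go to a single box -/

/-- Every box needs a red center, so centers and boxes match up bijectively, and the powers of five
force the blue voters of each cell to follow the center of that cell. -/
theorem votes_agree_of_red_wins {α β : Type*} [DecidableEq β] (C : Finset α)
    (B : Finset β) (hcard : B.card = C.card) (e : α → ℕ) (he : Set.InjOn e C)
    (g : α → β) (h : α → Fin 4 → β) (hg : ∀ c ∈ C, g c ∈ B) (hh : ∀ c ∈ C, ∀ t, h c t ∈ B)
    (hwin : ∀ b ∈ B, ∑ c ∈ C, ∑ t, (if h c t = b then 5 ^ e c else 0)
      < ∑ c ∈ C, if g c = b then 4 * 5 ^ e c + 1 else 0) :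
    Set.InjOn g C ∧ ∀ c ∈ C, ∀ t, h c t = g c := by
  have hsurj : ∀ b ∈ B, ∃ c ∈ C, g c = b := by
    intro b hb
    have hpos := (Nat.zero_le _).trans_lt (hwin b hb)
    obtain ⟨c, hc, hne⟩ := Finset.exists_ne_zero_of_sum_ne_zero hpos.ne'
    exact ⟨c, hc, by by_contra hgc; exact hne (if_neg hgc)⟩
  have hinj : Set.InjOn g C :=
    Finset.injOn_of_surjOn_of_card_le g (fun c hc => hg c hc) (fun b hb => hsurj b hb) hcard.ge
  have hload : ∀ c ∈ C, ∑ c' ∈ C, ∑ t, (if h c' t = g c then 5 ^ e c' else 0) ≤ 4 * 5 ^ e c := by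
    intro c hc
    have hw := hwin (g c) (hg c hc)
    rw [Finset.sum_eq_single_of_mem (f := fun c' => if g c' = g c then 4 * 5 ^ e c' + 1 else 0) c hc
      (fun c' hc' hne => if_neg fun heq => hne (hinj hc' hc heq)), if_pos rfl] at hw
    omega
  refine ⟨hinj, ?_⟩
  by_contra! hbad
  obtain ⟨c₀, hc₀, t₀, ht₀⟩ := hbad
  obtain ⟨c, hc, hmax⟩ := Finset.exists_max_image (C.filter fun c => ∃ t, h c t ≠ g c) e
    ⟨c₀, Finset.mem_filter.2 ⟨hc₀, t₀, ht₀⟩⟩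
  obtain ⟨hcC, t, ht⟩ := Finset.mem_filter.1 hc
  obtain ⟨d, hd, hgd⟩ := hsurj (h c t) (hh c hcC t)
  have hdc : d ≠ c := by
    rintro rfl
    exact ht hgd.symm
  have hterm : 5 ^ e c ≤ ∑ t, (if h c t = g d then 5 ^ e c else 0) := by
    have := Finset.single_le_sum (f := fun t => if h c t = g d then 5 ^ e c else 0)
      (fun _ _ => Nat.zero_le _) (Finset.mem_univ t)
    simpa [hgd] using this
  rcases lt_or_ge (e c) (e d) with hlt | hge
  · have hagree : ∀ t, h d t = g d := by
      by_contra! hne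
      exact absurd (hmax d (Finset.mem_filter.2 ⟨hd, hne⟩)) (not_le.2 hlt)
    have hpair := Finset.add_le_sum
      (f := fun c' => ∑ t, (if h c' t = g d then 5 ^ e c' else 0))
      (fun _ _ => Nat.zero_le _) hd hcC hdc
    have hown : ∑ t, (if h d t = g d then 5 ^ e d else 0) = 4 * 5 ^ e d := by simp [hagree]
    have := hload d hd
    have : 0 < 5 ^ e c := by positivity
    simp only [hown] at hpair
    omega
  · have hlt : e d < e c := lt_of_le_of_ne hge fun heq => hdc (he hd hcC heq)
    have hsingle := Finset.single_le_sum
      (f := fun c' => ∑ t, (if h c' t = g d then 5 ^ e c' else 0))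
      (fun _ _ => Nat.zero_le _) hcC
    have hld := hload d hd
    have hpow : 5 ^ (e d + 1) ≤ 5 ^ e c := Nat.pow_le_pow_right (by norm_num) hlt
    have : 0 < 5 ^ e d := by positivity
    rw [pow_succ] at hpow
    omega

/-! ### Estimates inside and between cells

Coordinates are relative to the center of a cell. The blue voters are at distance
`5 * N ^ 2 + 2 * N - 1` from the center and boxes are at sup-distance at most `2 * N` from it. -/

theorem sq_add_sq_lt_of_far {N x y z w : ℝ} (hN : 1 ≤ N)
    (hx : |x| ≤ 5 * N ^ 2 + 4 * N - 1) (hy : |y| ≤ 2 * N) (hz : 10 * N ^ 2 + 2 * N ≤ |z|) :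
    x ^ 2 + y ^ 2 < z ^ 2 + w ^ 2 := by
  have h1 : x ^ 2 ≤ (5 * N ^ 2 + 4 * N - 1) ^ 2 := sq_le_sq' (abs_le.1 hx).1 (abs_le.1 hx).2
  have h2 : y ^ 2 ≤ (2 * N) ^ 2 := sq_le_sq' (abs_le.1 hy).1 (abs_le.1 hy).2
  have h3 : (5 * N ^ 2 + 4 * N - 1 + 2 * N) ^ 2 ≤ z ^ 2 := by
    rw [← sq_abs z]
    exact pow_le_pow_left₀ (by nlinarith) (by nlinarith) 2
  nlinarith [sq_nonneg w, mul_pos (show (0 : ℝ) < N by linarith)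
    (show 0 < 5 * N ^ 2 + 4 * N - 1 by nlinarith)]

theorem sq_add_sq_lt_of_facing {N a b a' b' : ℝ} (hN : 1 ≤ N) (ha : |a| ≤ 2 * N)
    (hb : |b| ≤ 2 * N) (ha' : |a'| ≤ 2 * N) (h : a + a' ≤ 0) :
    (5 * N ^ 2 + 2 * N - 1 + a) ^ 2 + b ^ 2 < (5 * N ^ 2 + 2 * N + 1 - a') ^ 2 + b' ^ 2 := by
  have h2 : b ^ 2 ≤ (2 * N) ^ 2 := sq_le_sq' (abs_le.1 hb).1 (abs_le.1 hb).2
  rw [abs_le] at ha ha'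
  have h3 : 2 * (10 * N ^ 2) ≤ (2 - (a + a')) * (10 * N ^ 2 + 4 * N + a - a') := by
    apply mul_le_mul <;> nlinarith
  nlinarith [sq_nonneg b']

theorem facing_offset_lt {N a b a' b' : ℝ} (hb' : |b'| ≤ 2 * N) (ha' : |a'| ≤ 2 * N)
    (h : (5 * N ^ 2 + 2 * N - 1 + a) ^ 2 + b ^ 2 < (5 * N ^ 2 + 2 * N + 1 - a') ^ 2 + b' ^ 2) :
    a + a' < 4 := by
  by_contra! hge
  have h2 : b' ^ 2 ≤ (2 * N) ^ 2 := sq_le_sq' (abs_le.1 hb').1 (abs_le.1 hb').2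
  rw [abs_le] at ha'
  have h3 : 2 * (10 * N ^ 2) ≤ ((a + a') - 2) * (10 * N ^ 2 + 4 * N + a - a') := by
    apply mul_le_mul <;> nlinarith
  nlinarith [sq_nonneg b]

theorem le_abs_mul_add {L N a : ℝ} {m : ℤ} (hL : 0 ≤ L) (ha : |a| ≤ N) (K : ℕ)
    (hm : (K : ℤ) ≤ |m|) : L * K - N ≤ |L * m + a| := by
  have h1 : (K : ℝ) ≤ |(m : ℝ)| := by exact_mod_cast hm
  have h2 : |L * m| ≤ |L * m + a| + |a| := by
    simpa using abs_sub (L * m + a) a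
  rw [abs_mul, abs_of_nonneg hL] at h2
  nlinarith [mul_le_mul_of_nonneg_left h1 hL]

/-- The box of a cell is closer to a position on the horizontal axis of the cell than a box of
another cell. -/
theorem own_box_closer_horizontal {N a b a' b' u : ℝ} {m l : ℤ} (hN : 1 ≤ N) (ha : |a| ≤ 2 * N)
    (hb : |b| ≤ 2 * N) (ha' : |a'| ≤ 2 * N) (hb' : |b'| ≤ 2 * N) (hne : m ≠ 0 ∨ l ≠ 0)
    (hm : l = 0 → |m| = 1 → a + a' = 0)
    (hu : u = 0 ∨ u = 5 * N ^ 2 + 2 * N - 1 ∨ u = -(5 * N ^ 2 + 2 * N - 1)) :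
    (u - a) ^ 2 + (0 - b) ^ 2 < (u - ((10 * N ^ 2 + 4 * N) * m + a')) ^ 2
      + (0 - ((10 * N ^ 2 + 4 * N) * l + b')) ^ 2 := by
  have hD : 0 ≤ 5 * N ^ 2 + 2 * N - 1 := by nlinarith
  have hL : 0 ≤ 10 * N ^ 2 + 4 * N := by nlinarith
  have huD : |u| ≤ 5 * N ^ 2 + 2 * N - 1 := by
    rcases hu with rfl | rfl | rfl <;> simp only [abs_zero, abs_neg, abs_of_nonneg hD, hD, le_refl]
  have hx : |u - a| ≤ 5 * N ^ 2 + 4 * N - 1 := by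
    have := abs_sub u a
    linarith
  have hy : |0 - b| ≤ 2 * N := by simpa using hb
  by_cases hl : l = 0
  · subst hl
    have hm0 : m ≠ 0 := by simpa using hne
    have hm1 : 1 ≤ |m| := Int.one_le_abs hm0
    rcases eq_or_lt_of_le hm1 with h1 | h2
    · have hsum := hm rfl h1.symm
      rw [abs_le] at ha'
      rcases (abs_eq (by norm_num : (0 : ℤ) ≤ 1)).1 h1.symm with rfl | rfl
      · by_cases hpos : u = 5 * N ^ 2 + 2 * N - 1
        · have := sq_add_sq_lt_of_facing (a := -a) (a' := -a') (b := b) (b' := b') hN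
            (by simpa using ha) hb (by rw [abs_le]; constructor <;> linarith) (by linarith)
          subst hpos
          push_cast
          convert this using 1 <;> ring
        · apply sq_add_sq_lt_of_far hN hx hy
          rw [le_abs]
          right
          rcases hu with rfl | h | rfl
          · push_cast; linarith
          · exact absurd h hpos
          · push_cast; nlinarith
      · by_cases hneg : u = -(5 * N ^ 2 + 2 * N - 1)
        · have := sq_add_sq_lt_of_facing (a := a) (a' := a') (b := b) (b' := b') hN
            ha hb (by rw [abs_le]; constructor <;> linarith) (by linarith)
          subst hneg
          push_cast
          convert this using 1 <;> ring
        · apply sq_add_sq_lt_of_far hN hx hy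
          rw [le_abs]
          left
          rcases hu with rfl | rfl | h
          · push_cast; linarith
          · push_cast; nlinarith
          · exact absurd h hneg
    · apply sq_add_sq_lt_of_far hN hx hy
      have hfar := le_abs_mul_add hL ha' 2 (by exact_mod_cast h2)
      have := abs_sub_abs_le_abs_sub ((10 * N ^ 2 + 4 * N) * (m : ℝ) + a') u
      rw [abs_sub_comm]
      push_cast at hfar
      nlinarith
  · have hfar := le_abs_mul_add hL hb' 1 (by exact_mod_cast Int.one_le_abs hl)
    rw [add_comm (_ ^ 2) ((0 - ((10 * N ^ 2 + 4 * N) * (l : ℝ) + b')) ^ 2)]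
    apply sq_add_sq_lt_of_far hN hx hy
    rw [zero_sub, abs_neg]
    push_cast at hfar
    linarith

/-- Two boxes of a cell cannot differ if one of them attracts all four blue voters of the cell. -/
theorem not_forall_blue_closer {N a b a' b' : ℝ} (hN : 1 ≤ N) (ha : |a| ≤ 2 * N)
    (hb : |b| ≤ 2 * N) (ha' : |a'| ≤ 2 * N) (hb' : |b'| ≤ 2 * N)
    (hl : (-(5 * N ^ 2 + 2 * N - 1) - a') ^ 2 + (0 - b') ^ 2
      < (-(5 * N ^ 2 + 2 * N - 1) - a) ^ 2 + (0 - b) ^ 2)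
    (hr : (5 * N ^ 2 + 2 * N - 1 - a') ^ 2 + (0 - b') ^ 2
      < (5 * N ^ 2 + 2 * N - 1 - a) ^ 2 + (0 - b) ^ 2)
    (hu : (0 - a') ^ 2 + (-(5 * N ^ 2 + 2 * N - 1) - b') ^ 2
      < (0 - a) ^ 2 + (-(5 * N ^ 2 + 2 * N - 1) - b) ^ 2)
    (hd : (0 - a') ^ 2 + (5 * N ^ 2 + 2 * N - 1 - b') ^ 2
      < (0 - a) ^ 2 + (5 * N ^ 2 + 2 * N - 1 - b) ^ 2) : False := by
  have hD : 4 * N ≤ 5 * N ^ 2 + 2 * N - 1 := by nlinarith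
  have key : ∀ x y : ℝ, |x| ≤ 2 * N → |y| ≤ 2 * N → x ^ 2 - y ^ 2 ≤ 4 * N * |x - y| := by
    intro x y hx hy
    calc x ^ 2 - y ^ 2 = (x + y) * (x - y) := by ring
      _ ≤ |x + y| * |x - y| := by rw [← abs_mul]; exact le_abs_self _
      _ ≤ 4 * N * |x - y| := by
        gcongr
        linarith [abs_add_le x y]
  have h1 := key a a' ha ha'
  have h2 := key b b' hb hb'
  generalize 5 * N ^ 2 + 2 * N - 1 = D at *
  have hA : 2 * D * |a - a'| < a ^ 2 - a' ^ 2 + (b ^ 2 - b' ^ 2) := by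
    rcases abs_cases (a - a') with ⟨h, -⟩ | ⟨h, -⟩ <;> rw [h] <;> linarith
  have hB : 2 * D * |b - b'| < a ^ 2 - a' ^ 2 + (b ^ 2 - b' ^ 2) := by
    rcases abs_cases (b - b') with ⟨h, -⟩ | ⟨h, -⟩ <;> rw [h] <;> linarith
  nlinarith [mul_le_mul_of_nonneg_right hD (abs_nonneg (a - a')),
    mul_le_mul_of_nonneg_right hD (abs_nonneg (b - b'))]

/-! ### Positions relative to cell centers -/

theorem edist2_lt_iff {v b b' : ℝ × ℝ} : edist2 v b < edist2 v b' ↔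
    (v.1 - b.1) ^ 2 + (v.2 - b.2) ^ 2 < (v.1 - b'.1) ^ 2 + (v.2 - b'.2) ^ 2 :=
  Real.sqrt_lt_sqrt_iff (by positivity)

theorem nearestIn.eq {B' : Set (ℝ × ℝ)} {v b b' : ℝ × ℝ} (h : nearestIn B' v b)
    (h' : nearestIn B' v b') : b = b' := by
  by_contra hne
  exact lt_asymm (h.2 b' h'.1 (Ne.symm hne)) (h'.2 b h.1 hne)

theorem nearestIn.iff_eq {B' : Set (ℝ × ℝ)} {v b b' : ℝ × ℝ} (h : nearestIn B' v b) :
    nearestIn B' v b' ↔ b = b' :=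
  ⟨h.eq, fun hb => hb ▸ h⟩

/-- A coordinate of the center of a cell. -/
def cellCenter (n i : ℕ) : ℝ := Lc n * ((i : ℝ) - 1) + 5 * (n : ℝ) ^ 2 + 2 * (n : ℝ)

/-- A coordinate of a ballot box relative to the center of its cell. -/
def boxOffset (n i p : ℕ) : ℝ :=
  if Even i then 4 * (p : ℝ) - 2 * (n : ℝ) else 2 * (n : ℝ) - 4 * (p : ℝ)

/-- The four blue voter positions relative to the center of their cell. -/
def blueOffset (n : ℕ) : Fin 4 → ℝ × ℝ :=
  ![(-(5 * (n : ℝ) ^ 2 + 2 * n - 1), 0), (5 * (n : ℝ) ^ 2 + 2 * n - 1, 0),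
    (0, -(5 * (n : ℝ) ^ 2 + 2 * n - 1)), (0, 5 * (n : ℝ) ^ 2 + 2 * n - 1)]

/-- The four blue voter positions of a cell. -/
def blueVoter (n i j : ℕ) : Fin 4 → ℝ × ℝ := ![Vl n i j, Vr n i j, Vu n i j, Vd n i j]

theorem bbox_eq (n i j p q : ℕ) : bbox n i j p q =
    (cellCenter n i + boxOffset n i p, cellCenter n j + boxOffset n j q) := by
  unfold bbox cellCenter boxOffset
  ext <;> dsimp only <;> split_ifs <;> ring

theorem cpos_eq (n i j : ℕ) : cpos n i j = (cellCenter n i + 0, cellCenter n j + 0) := by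
  simp [cpos, cellCenter]

theorem blueVoter_eq (n i j : ℕ) (t : Fin 4) : blueVoter n i j t =
    (cellCenter n i + (blueOffset n t).1, cellCenter n j + (blueOffset n t).2) := by
  fin_cases t <;> ext <;>
    simp [blueVoter, blueOffset, Vl, Vr, Vu, Vd, cellCenter, Lc] <;> ring

theorem cellCenter_eq_add (n i i' : ℕ) : cellCenter n i' = cellCenter n i +
    (10 * (n : ℝ) ^ 2 + 4 * n) * (((i' : ℤ) - (i : ℤ) : ℤ) : ℝ) := by
  simp only [cellCenter, Lc]
  push_cast
  ring

theorem abs_boxOffset_le {n p : ℕ} (i : ℕ) (hp : p ≤ n) : |boxOffset n i p| ≤ 2 * n := by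
  have : (p : ℝ) ≤ n := by exact_mod_cast hp
  have : (0 : ℝ) ≤ p := by positivity
  unfold boxOffset
  rw [abs_le]
  split_ifs <;> constructor <;> linarith

theorem boxOffset_add_succ (n i p q : ℕ) :
    boxOffset n i p + boxOffset n (i + 1) q = 4 * ((p : ℝ) - q) ∨
      boxOffset n i p + boxOffset n (i + 1) q = 4 * ((q : ℝ) - p) := by
  unfold boxOffset
  by_cases h : Even i
  · left
    simp [h, Nat.even_add_one]
    ring
  · right
    simp [h, Nat.even_add_one]
    ring

theorem eq_of_abs_boxOffset_add_succ_lt {n i p q : ℕ}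
    (h : |boxOffset n i p + boxOffset n (i + 1) q| < 4) : p = q := by
  have hpq : |(p : ℝ) - q| < 1 := by
    rcases boxOffset_add_succ n i p q with he | he <;> rw [he, abs_mul] at h
    · norm_num at h; exact h
    · rw [abs_sub_comm]; norm_num at h; exact h
  have : |(p : ℤ) - q| < 1 := by exact_mod_cast hpq
  rw [Int.abs_lt_one_iff] at this
  omega

/-- In the frame of the cell `(i, j)`: comparing distances from a position given relative to the
center of `(i, j)` to a box of that cell and a box of any cell `(i', j')`. -/
theorem edist2_bbox_lt_iff {n i j i' j' p q p' q' : ℕ} {u w : ℝ} :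
    edist2 (cellCenter n i + u, cellCenter n j + w) (bbox n i j p q) <
      edist2 (cellCenter n i + u, cellCenter n j + w) (bbox n i' j' p' q') ↔
    (u - boxOffset n i p) ^ 2 + (w - boxOffset n j q) ^ 2 <
      (u - ((10 * (n : ℝ) ^ 2 + 4 * n) * (((i' : ℤ) - (i : ℤ) : ℤ) : ℝ) + boxOffset n i' p')) ^ 2
      + (w - ((10 * (n : ℝ) ^ 2 + 4 * n) * (((j' : ℤ) - (j : ℤ) : ℤ) : ℝ)
        + boxOffset n j' q')) ^ 2 := by
  rw [edist2_lt_iff, bbox_eq, bbox_eq, cellCenter_eq_add n i i', cellCenter_eq_add n j j']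
  dsimp only
  rw [add_sub_add_left_eq_sub, add_sub_add_left_eq_sub, add_assoc, add_assoc,
    add_sub_add_left_eq_sub, add_sub_add_left_eq_sub]

theorem center_closer {n i j i' j' p q p' q' : ℕ} (hn : 1 ≤ n) (hp : p ≤ n) (hq : q ≤ n)
    (hp' : p' ≤ n) (hq' : q' ≤ n) (hne : (i', j') ≠ (i, j)) :
    edist2 (cpos n i j) (bbox n i j p q) < edist2 (cpos n i j) (bbox n i' j' p' q') := by
  have hN : (1 : ℝ) ≤ n := by exact_mod_cast hn
  have hL : 0 ≤ 10 * (n : ℝ) ^ 2 + 4 * n := by positivity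
  have hx : |0 - boxOffset n i p| ≤ 5 * (n : ℝ) ^ 2 + 4 * n - 1 := by
    have := abs_boxOffset_le i hp
    rw [zero_sub, abs_neg]
    nlinarith
  have hy : |0 - boxOffset n j q| ≤ 2 * (n : ℝ) := by
    simpa using abs_boxOffset_le j hq
  have hfar : ∀ (m : ℤ) (a : ℝ), |a| ≤ 2 * (n : ℝ) → m ≠ 0 →
      10 * (n : ℝ) ^ 2 + 2 * n ≤ |0 - ((10 * (n : ℝ) ^ 2 + 4 * n) * (m : ℝ) + a)| := by
    intro m a ha hm
    have := le_abs_mul_add hL ha 1 (by exact_mod_cast Int.one_le_abs hm)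
    rw [zero_sub, abs_neg]
    push_cast at this
    linarith
  rw [cpos_eq, edist2_bbox_lt_iff]
  by_cases hi : (i' : ℤ) - i = 0
  · have hj : (j' : ℤ) - j ≠ 0 := fun hj => hne (Prod.ext (by grind) (by grind))
    rw [add_comm ((0 - ((10 * (n : ℝ) ^ 2 + 4 * n) * _ + _)) ^ 2)]
    exact sq_add_sq_lt_of_far hN hx hy (hfar _ _ (abs_boxOffset_le j' hq') hj)
  · exact sq_add_sq_lt_of_far hN hx hy (hfar _ _ (abs_boxOffset_le i' hp') hi)

theorem blue_closer {n i j i' j' p q p' q' : ℕ} (hn : 1 ≤ n) (hp : p ≤ n) (hq : q ≤ n)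
    (hp' : p' ≤ n) (hq' : q' ≤ n) (hne : (i', j') ≠ (i, j))
    (hx : j' = j → i' = i + 1 ∨ i = i' + 1 → p = p')
    (hy : i' = i → j' = j + 1 ∨ j = j' + 1 → q = q') (t : Fin 4) :
    edist2 (blueVoter n i j t) (bbox n i j p q) <
      edist2 (blueVoter n i j t) (bbox n i' j' p' q') := by
  have hN : (1 : ℝ) ≤ n := by exact_mod_cast hn
  have opposite : ∀ a a' r r' : ℕ, |(a' : ℤ) - a| = 1 → (a' = a + 1 ∨ a = a' + 1 → r = r') →
      boxOffset n a r + boxOffset n a' r' = 0 := by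
    intro a a' r r' habs hr
    have hcase : a' = a + 1 ∨ a = a' + 1 := by grind
    obtain rfl := hr hcase
    rcases hcase with rfl | rfl
    · rcases boxOffset_add_succ n a r r with h | h <;> rw [h] <;> ring
    · rw [add_comm]
      rcases boxOffset_add_succ n a' r r with h | h <;> rw [h] <;> ring
  have hij : (i' : ℤ) - i ≠ 0 ∨ (j' : ℤ) - j ≠ 0 := by
    by_contra! h
    exact hne (Prod.ext (by grind) (by grind))
  have horiz := fun u => own_box_closer_horizontal (u := u) hN (abs_boxOffset_le i hp)
    (abs_boxOffset_le j hq) (abs_boxOffset_le i' hp') (abs_boxOffset_le j' hq') hij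
    (fun hl hm => opposite i i' p p' hm (hx (by omega)))
  have vert := fun u => own_box_closer_horizontal (u := u) hN (abs_boxOffset_le j hq)
    (abs_boxOffset_le i hp) (abs_boxOffset_le j' hq') (abs_boxOffset_le i' hp') hij.symm
    (fun hl hm => opposite j j' q q' hm (hy (by omega)))
  rw [blueVoter_eq, edist2_bbox_lt_iff]
  fin_cases t
  · exact horiz _ (.inr (.inr rfl))
  · exact horiz _ (.inr (.inl rfl))
  · rw [add_comm, add_comm ((_ - (_ + boxOffset n i' p')) ^ 2)]
    exact vert _ (.inr (.inr rfl))
  · rw [add_comm, add_comm ((_ - (_ + boxOffset n i' p')) ^ 2)]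
    exact vert _ (.inr (.inl rfl))

theorem not_forall_blueVoter_closer {n i j p q p' q' : ℕ} (hn : 1 ≤ n) (hp : p ≤ n) (hq : q ≤ n)
    (hp' : p' ≤ n) (hq' : q' ≤ n) :
    ¬ ∀ t, edist2 (blueVoter n i j t) (bbox n i j p' q') <
      edist2 (blueVoter n i j t) (bbox n i j p q) := by
  intro h
  simp only [blueVoter_eq, edist2_bbox_lt_iff, sub_self, Int.cast_zero, mul_zero, zero_add] at h
  exact not_forall_blue_closer (by exact_mod_cast hn) (abs_boxOffset_le i hp)
    (abs_boxOffset_le j hq) (abs_boxOffset_le i hp') (abs_boxOffset_le j hq')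
    (h 0) (h 1) (h 2) (h 3)

theorem eq_of_horizontal_closer {n i j p q p' q' : ℕ} (hp : p ≤ n) (hq : q ≤ n)
    (hp' : p' ≤ n) (hq' : q' ≤ n)
    (hr : edist2 (blueVoter n i j 1) (bbox n i j p q) <
      edist2 (blueVoter n i j 1) (bbox n (i + 1) j p' q'))
    (hl : edist2 (blueVoter n (i + 1) j 0) (bbox n (i + 1) j p' q') <
      edist2 (blueVoter n (i + 1) j 0) (bbox n i j p q)) : p = p' := by
  have ha := abs_boxOffset_le i hp
  have ha' := abs_boxOffset_le (i + 1) hp'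
  have hb := abs_boxOffset_le j hq
  have hb' := abs_boxOffset_le j hq'
  rw [blueVoter_eq, edist2_bbox_lt_iff] at hr hl
  simp only [blueOffset, Matrix.cons_val] at hr hl
  push_cast at hr hl
  apply eq_of_abs_boxOffset_add_succ_lt
  rw [abs_lt]
  constructor
  · have := facing_offset_lt (a := -boxOffset n i p) (a' := -boxOffset n (i + 1) p')
      (b := boxOffset n j q) (b' := boxOffset n j q') hb' (by simpa using ha')
      (by convert hr using 1 <;> ring)
    linarith
  · have := facing_offset_lt (a := boxOffset n (i + 1) p') (a' := boxOffset n i p)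
      (b := boxOffset n j q') (b' := boxOffset n j q) hb ha
      (by convert hl using 1 <;> ring)
    linarith

theorem eq_of_vertical_closer {n i j p q p' q' : ℕ} (hp : p ≤ n) (hq : q ≤ n)
    (hp' : p' ≤ n) (hq' : q' ≤ n)
    (hd : edist2 (blueVoter n i j 3) (bbox n i j p q) <
      edist2 (blueVoter n i j 3) (bbox n i (j + 1) p' q'))
    (hu : edist2 (blueVoter n i (j + 1) 2) (bbox n i (j + 1) p' q') <
      edist2 (blueVoter n i (j + 1) 2) (bbox n i j p q)) : q = q' := by
  have swap : ∀ v b : ℝ × ℝ, edist2 v.swap b.swap = edist2 v b := by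
    intro v b
    simp [edist2, add_comm]
  have hbox : ∀ i j p q, bbox n i j p q = (bbox n j i q p).swap := fun _ _ _ _ => rfl
  have h3 : blueVoter n i j 3 = (blueVoter n j i 1).swap := rfl
  have h2 : blueVoter n i (j + 1) 2 = (blueVoter n (j + 1) i 0).swap := rfl
  rw [h3, hbox, hbox i (j + 1), swap, swap] at hd
  rw [h2, hbox, hbox i j, swap, swap] at hu
  exact eq_of_horizontal_closer hq hp hq' hp' hd hu

/-! ### The election -/

/-- The cells of the grid. -/
def cells (k : ℕ) : Finset (ℕ × ℕ) := Finset.Icc 1 k ×ˢ Finset.Icc 1 k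

theorem mem_cells {k i j : ℕ} : (i, j) ∈ cells k ↔ 1 ≤ i ∧ i ≤ k ∧ 1 ≤ j ∧ j ≤ k := by
  simp [cells, and_assoc]

/-- The exponent of the number of voters in a cell. -/
def cellExponent (k : ℕ) (c : ℕ × ℕ) : ℕ := (c.1 - 1) * k + (c.2 - 1)

theorem cellExponent_injOn (k : ℕ) : Set.InjOn (cellExponent k) (cells k) := by
  rintro ⟨i, j⟩ hc ⟨i', j'⟩ hc' h
  obtain ⟨hi, hik, hj, hjk⟩ := mem_cells.1 (Finset.mem_coe.1 hc)
  obtain ⟨hi', hik', hj', hjk'⟩ := mem_cells.1 (Finset.mem_coe.1 hc')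
  simp only [cellExponent] at h
  have h1 := congrArg (· / k) h
  have h2 := congrArg (· % k) h
  simp only [Nat.mul_add_mod_self_right, Nat.mod_eq_of_lt (show j - 1 < k by omega),
    Nat.mod_eq_of_lt (show j' - 1 < k by omega)] at h2
  rw [h2, Nat.add_right_cancel_iff] at h
  have := Nat.eq_of_mul_eq_mul_right (by omega) h
  exact Prod.ext (by grind) (by grind)

theorem blueVoter_mem_allPositions {k n : ℕ} {c : ℕ × ℕ} (hc : c ∈ cells k) (t : Fin 4) :
    blueVoter n c.1 c.2 t ∈ allPositions k n := by
  obtain ⟨h1, h2, h3, h4⟩ := mem_cells.1 hc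
  refine ⟨c.1, c.2, h1, h2, h3, h4, ?_⟩
  fin_cases t <;> simp [blueVoter, fivePos]

theorem cpos_mem_allPositions {k n : ℕ} {c : ℕ × ℕ} (hc : c ∈ cells k) :
    cpos n c.1 c.2 ∈ allPositions k n := by
  obtain ⟨h1, h2, h3, h4⟩ := mem_cells.1 hc
  exact ⟨c.1, c.2, h1, h2, h3, h4, by simp [fivePos]⟩

theorem redWins_iff {k n : ℕ} {B' : Set (ℝ × ℝ)} {g : ℕ × ℕ → ℝ × ℝ}
    {h : ℕ × ℕ → Fin 4 → ℝ × ℝ} (hg : ∀ c ∈ cells k, nearestIn B' (cpos n c.1 c.2) (g c))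
    (hh : ∀ c ∈ cells k, ∀ t, nearestIn B' (blueVoter n c.1 c.2 t) (h c t)) (b : ℝ × ℝ) :
    redWins k n B' b ↔ ∑ c ∈ cells k, ∑ t, (if h c t = b then 5 ^ cellExponent k c else 0)
      < ∑ c ∈ cells k, if g c = b then 4 * 5 ^ cellExponent k c + 1 else 0 := by
  have hred : redCount k n B' b =
      ∑ c ∈ cells k, if g c = b then 4 * 5 ^ cellExponent k c + 1 else 0 := by
    rw [redCount, ← Finset.sum_product']
    refine Finset.sum_congr rfl fun c hc => ?_
    simp only [(hg c hc).iff_eq, cellExponent]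
  have hblue : blueCount k n B' b =
      ∑ c ∈ cells k, ∑ t, (if h c t = b then 5 ^ cellExponent k c else 0) := by
    rw [blueCount, ← Finset.sum_product']
    refine Finset.sum_congr rfl fun c hc => ?_
    simp only [Fin.sum_univ_four, ← (hh c hc _).iff_eq, cellExponent]
    rfl
  rw [redWins, hred, hblue]

theorem exists_red_boxes_of_isGridSolution {k n : ℕ} (hn : 1 ≤ n) {S : ℕ → ℕ → Set (ℕ × ℕ)}
    (hS : ∀ c ∈ cells k, ∀ pq ∈ S c.1 c.2, pq.1 ≤ n ∧ pq.2 ≤ n) {s : ℕ → ℕ → ℕ × ℕ}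
    (hs : IsGridSolution k S s) :
    ∃ B' : Set (ℝ × ℝ), B' ⊆ Bset k n S ∧ B'.ncard = k ^ 2 ∧
      (∀ v ∈ allPositions k n, ∃ b, nearestIn B' v b) ∧ (∀ b ∈ B', redWins k n B' b) := by
  obtain ⟨hmem, hrow, hcol⟩ := hs
  have hmemS : ∀ c ∈ cells k, s c.1 c.2 ∈ S c.1 c.2 := by
    intro c hc
    obtain ⟨h1, h2, h3, h4⟩ := mem_cells.1 hc
    exact hmem _ _ h1 h2 h3 h4
  have hle : ∀ c ∈ cells k, (s c.1 c.2).1 ≤ n ∧ (s c.1 c.2).2 ≤ n :=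
    fun c hc => hS c hc _ (hmemS c hc)
  let f : ℕ × ℕ → ℝ × ℝ := fun c => bbox n c.1 c.2 (s c.1 c.2).1 (s c.1 c.2).2
  have hcenter : ∀ c ∈ cells k, ∀ c' ∈ cells k, c' ≠ c →
      edist2 (cpos n c.1 c.2) (f c) < edist2 (cpos n c.1 c.2) (f c') := fun c hc c' hc' hne =>
    center_closer hn (hle c hc).1 (hle c hc).2 (hle c' hc').1 (hle c' hc').2 hne
  have hblue : ∀ c ∈ cells k, ∀ c' ∈ cells k, c' ≠ c → ∀ t,
      edist2 (blueVoter n c.1 c.2 t) (f c) < edist2 (blueVoter n c.1 c.2 t) (f c') := by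
    rintro ⟨i, j⟩ hc ⟨i', j'⟩ hc' hne
    apply blue_closer hn (hle _ hc).1 (hle _ hc).2 (hle _ hc').1 (hle _ hc').2 hne
    all_goals
      obtain ⟨h1, h2, h3, h4⟩ := mem_cells.1 hc
      obtain ⟨h1', h2', h3', h4'⟩ := mem_cells.1 hc'
      dsimp only
    · rintro rfl (rfl | rfl)
      · exact hrow i j' h1 (by omega) h3 h4
      · exact (hrow i' j' h1' (by omega) h3 h4).symm
    · rintro rfl (rfl | rfl)
      · exact hcol i' j h1 h2 h3 (by omega)
      · exact (hcol i' j' h1 h2 h3' (by omega)).symm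
  have hinj : Set.InjOn f (cells k) := by
    intro c hc c' hc' heq
    by_contra hne
    exact (hcenter c hc c' hc' (Ne.symm hne)).ne (by rw [heq])
  have nearest : ∀ c ∈ cells k, ∀ v : ℝ × ℝ,
      (∀ c' ∈ cells k, c' ≠ c → edist2 v (f c) < edist2 v (f c')) →
      nearestIn (f '' cells k) v (f c) := by
    rintro c hc v hv
    refine ⟨⟨c, hc, rfl⟩, ?_⟩
    rintro _ ⟨c', hc', rfl⟩ hne
    exact hv c' hc' fun h => hne (by rw [h])
  have hg : ∀ c ∈ cells k, nearestIn (f '' cells k) (cpos n c.1 c.2) (f c) :=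
    fun c hc => nearest c hc _ (hcenter c hc)
  have hh : ∀ c ∈ cells k, ∀ t, nearestIn (f '' cells k) (blueVoter n c.1 c.2 t) (f c) :=
    fun c hc t => nearest c hc _ fun c' hc' hne => hblue c hc c' hc' hne t
  refine ⟨f '' cells k, ?_, ?_, ?_, ?_⟩
  · rintro _ ⟨c, hc, rfl⟩
    obtain ⟨h1, h2, h3, h4⟩ := mem_cells.1 (Finset.mem_coe.1 hc)
    exact ⟨c.1, c.2, _, _, h1, h2, h3, h4, hmemS c hc, rfl⟩
  · rw [hinj.ncard_image, Set.ncard_coe_finset]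
    simp [cells, sq]
  · rintro v ⟨i, j, h1, h2, h3, h4, hv⟩
    have hc : (i, j) ∈ cells k := mem_cells.2 ⟨h1, h2, h3, h4⟩
    refine ⟨f (i, j), ?_⟩
    rcases hv with rfl | rfl | rfl | rfl | rfl
    · exact hg _ hc
    · exact hh _ hc 0
    · exact hh _ hc 1
    · exact hh _ hc 2
    · exact hh _ hc 3
  · rintro _ ⟨c, hc, rfl⟩
    rw [redWins_iff (h := fun c _ => f c) hg hh]
    refine Finset.sum_lt_sum (fun c' _ => ?_) ⟨c, hc, ?_⟩
    · split_ifs <;> simp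
    · simp

theorem exists_isGridSolution_of_red_boxes {k n : ℕ} (hk : 1 ≤ k) (hn : 1 ≤ n)
    {S : ℕ → ℕ → Set (ℕ × ℕ)} (hS : ∀ c ∈ cells k, ∀ pq ∈ S c.1 c.2, pq.1 ≤ n ∧ pq.2 ≤ n)
    {B' : Set (ℝ × ℝ)} (hsub : B' ⊆ Bset k n S) (hcard : B'.ncard = k ^ 2)
    (hvote : ∀ v ∈ allPositions k n, ∃ b, nearestIn B' v b) (hwin : ∀ b ∈ B', redWins k n B' b) :
    ∃ s : ℕ → ℕ → ℕ × ℕ, IsGridSolution k S s := by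
  choose! vote hnear using hvote
  let g : ℕ × ℕ → ℝ × ℝ := fun c => vote (cpos n c.1 c.2)
  have hg : ∀ c ∈ cells k, nearestIn B' (cpos n c.1 c.2) (g c) :=
    fun c hc => hnear _ (cpos_mem_allPositions hc)
  have hh : ∀ c ∈ cells k, ∀ t, nearestIn B' (blueVoter n c.1 c.2 t)
      (vote (blueVoter n c.1 c.2 t)) := fun c hc t => hnear _ (blueVoter_mem_allPositions hc t)
  have hfin : B'.Finite := Set.finite_of_ncard_pos (by rw [hcard]; positivity)
  obtain ⟨hinj, hagree⟩ := votes_agree_of_red_wins (cells k) hfin.toFinset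
    (by rw [← Set.ncard_eq_toFinset_card B' hfin, hcard]; simp [cells, sq])
    (cellExponent k) (cellExponent_injOn k) g (fun c t => vote (blueVoter n c.1 c.2 t))
    (fun c hc => hfin.mem_toFinset.2 (hg c hc).1)
    (fun c hc t => hfin.mem_toFinset.2 (hh c hc t).1)
    (fun b hb => (redWins_iff hg hh b).1 (hwin b (hfin.mem_toFinset.1 hb)))
  have hblue : ∀ c ∈ cells k, ∀ t, nearestIn B' (blueVoter n c.1 c.2 t) (g c) :=
    fun c hc t => hagree c hc t ▸ hh c hc t
  have hbox : ∀ b ∈ B', ∃ c ∈ cells k, ∃ pq ∈ S c.1 c.2, b = bbox n c.1 c.2 pq.1 pq.2 := by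
    intro b hb
    obtain ⟨i, j, p, q, h1, h2, h3, h4, hpq, rfl⟩ := hsub hb
    exact ⟨(i, j), mem_cells.2 ⟨h1, h2, h3, h4⟩, (p, q), hpq, rfl⟩
  have hown : ∀ c ∈ cells k, ∃ pq ∈ S c.1 c.2, g c = bbox n c.1 c.2 pq.1 pq.2 := by
    intro c hc
    obtain ⟨d, hd, pq, hpq, hgc⟩ := hbox (g c) (hg c hc).1
    by_cases hdc : d = c
    · subst hdc
      exact ⟨pq, hpq, hgc⟩
    exfalso
    have hne : g c ≠ g d := fun h => hdc (hinj hc hd h).symm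
    obtain ⟨d', hd', pq', hpq', hgd⟩ := hbox (g d) (hg d hd).1
    have hle := hS d hd pq hpq
    have hle' := hS d' hd' pq' hpq'
    by_cases hdd : d' = d
    · subst hdd
      refine not_forall_blueVoter_closer (i := d'.1) (j := d'.2) hn hle.1 hle.2 hle'.1 hle'.2
        fun t => ?_
      rw [← hgc, ← hgd]
      exact (hblue d' hd t).2 (g c) (hg c hc).1 hne
    · have h1 := (hg d hd).2 (g c) (hg c hc).1 hne
      have h2 := center_closer (i := d.1) (j := d.2) (i' := d'.1) (j' := d'.2) hn hle.1 hle.2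
        hle'.1 hle'.2 hdd
      rw [← hgc, ← hgd] at h2
      exact lt_asymm h1 h2
  choose! s hsS hs using hown
  have hlt : ∀ c ∈ cells k, ∀ c' ∈ cells k, c' ≠ c → ∀ t,
      edist2 (blueVoter n c.1 c.2 t) (bbox n c.1 c.2 (s c).1 (s c).2) <
        edist2 (blueVoter n c.1 c.2 t) (bbox n c'.1 c'.2 (s c').1 (s c').2) := by
    intro c hc c' hc' hne t
    rw [← hs c hc, ← hs c' hc']
    exact (hblue c hc t).2 _ (hg c' hc').1 fun h => hne (hinj hc' hc h)
  refine ⟨fun i j => s (i, j), fun i j h1 h2 h3 h4 => hsS _ (mem_cells.2 ⟨h1, h2, h3, h4⟩),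
    fun i j h1 h2 h3 h4 => ?_, fun i j h1 h2 h3 h4 => ?_⟩
  · have hc : (i, j) ∈ cells k := mem_cells.2 ⟨h1, h2.le, h3, h4⟩
    have hc' : (i + 1, j) ∈ cells k := mem_cells.2 ⟨by omega, h2, h3, h4⟩
    have hle := hS _ hc _ (hsS _ hc)
    have hle' := hS _ hc' _ (hsS _ hc')
    exact eq_of_horizontal_closer hle.1 hle.2 hle'.1 hle'.2
      (hlt _ hc _ hc' (by simp) 1) (hlt _ hc' _ hc (by simp) 0)
  · have hc : (i, j) ∈ cells k := mem_cells.2 ⟨h1, h2, h3, h4.le⟩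
    have hc' : (i, j + 1) ∈ cells k := mem_cells.2 ⟨h1, h2, by omega, h4⟩
    have hle := hS _ hc _ (hsS _ hc)
    have hle' := hS _ hc' _ (hsS _ hc')
    exact eq_of_vertical_closer hle.1 hle.2 hle'.1 hle'.2
      (hlt _ hc _ hc' (by simp) 3) (hlt _ hc' _ hc (by simp) 2)

/-- Correctness of the reduction: the grid-tiling instance `S` has a solution
iff there is a set `B'` of `k²` available ballot boxes such that every voter
position has a unique nearest box of `B'` and red wins at every box of `B'`. -/
theorem grid_tiling_iff_gerrymandering (k n : ℕ) (hk : 1 ≤ k) (hn : 1 ≤ n)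
    (S : ℕ → ℕ → Set (ℕ × ℕ))
    (hSsub : ∀ i j, 1 ≤ i → i ≤ k → 1 ≤ j → j ≤ k →
      ∀ pq ∈ S i j, 1 ≤ pq.1 ∧ pq.1 ≤ n ∧ 1 ≤ pq.2 ∧ pq.2 ≤ n)
    (hSne : ∀ i j, 1 ≤ i → i ≤ k → 1 ≤ j → j ≤ k → (S i j).Nonempty) :
    (∃ s : ℕ → ℕ → ℕ × ℕ, IsGridSolution k S s) ↔
    (∃ B' : Set (ℝ × ℝ), B' ⊆ Bset k n S ∧ B'.ncard = k ^ 2 ∧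
      (∀ v ∈ allPositions k n, ∃ b, nearestIn B' v b) ∧
      (∀ b ∈ B', redWins k n B' b)) := by
  have hS : ∀ c ∈ cells k, ∀ pq ∈ S c.1 c.2, pq.1 ≤ n ∧ pq.2 ≤ n := by
    intro c hc pq hpq
    obtain ⟨h1, h2, h3, h4⟩ := mem_cells.1 hc
    obtain ⟨-, hp, -, hq⟩ := hSsub _ _ h1 h2 h3 h4 pq hpq
    exact ⟨hp, hq⟩
  constructor
  · rintro ⟨s, hs⟩
    exact exists_red_boxes_of_isGridSolution hn hS hs
  · rintro ⟨B', hsub, hcard, hvote, hwin⟩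
    exact exists_isGridSolution_of_red_boxes hk hn hS hsub hcard hvote hwin
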